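/- For every complex ζ and every τ in the complex upper half-plane, θ[1,3/5](τ)·θ[3/5,1/5](ζ,τ)²·θ[3/5,3/5](ζ,τ) + ζ₅·θ[1,1/5](τ)·θ[3/5,3/5](ζ,τ)²·θ[3/5,9/5](ζ,τ) − ζ₅²·θ[1,3/5](τ)·θ[3/5,9/5](ζ,τ)²·θ[3/5,7/5](ζ,τ) − ζ₅·θ[1,1/5](τ)·θ[3/5,7/5](ζ,τ)²·θ[3/5,1/5](ζ,τ) = 0. -/

import Mathlib

open Complex

/-- The theta function with characteristic `[ε; ε']`:
`θ[ε,ε'](ζ,τ) = ∑_{n ∈ ℤ} exp(2πi((1/2)(n+ε/2)²τ + (n+ε/2)(ζ+ε'/2)))`. -/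
noncomputable def θf (ε ε' : ℝ) (ζ τ : ℂ) : ℂ :=
  ∑' n : ℤ, Complex.exp (2 * Real.pi * Complex.I *
    ((1 / 2) * ((n : ℂ) + (ε : ℂ) / 2) ^ 2 * τ + ((n : ℂ) + (ε : ℂ) / 2) * (ζ + (ε' : ℂ) / 2)))

/-- The theta constant: the value of the theta function at `ζ = 0`. -/
noncomputable def θ (ε ε' : ℝ) (τ : ℂ) : ℂ := θf ε ε' 0 τ

/-- `ζ₅ = exp(2πi/5)`. -/
noncomputable def ζ₅ : ℂ := Complex.exp (2 * Real.pi * Complex.I / 5)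

lemma exp_two_pi_I_mul_int_add_half (k : ℤ) :
    cexp (2 * Real.pi * I * ((k : ℂ) + 1 / 2)) = -1 := by
  rw [show 2 * (Real.pi : ℂ) * I * ((k : ℂ) + 1 / 2) = k * (2 * Real.pi * I) + Real.pi * I by ring,
    Complex.exp_add, exp_int_mul_two_pi_mul_I, exp_pi_mul_I, one_mul]

/-- The summand of `θf`. -/
noncomputable def θfTerm (ε ε' : ℝ) (ζ τ : ℂ) (n : ℤ) : ℂ :=
  cexp (2 * Real.pi * I *
    ((1 / 2) * ((n : ℂ) + (ε : ℂ) / 2) ^ 2 * τ + ((n : ℂ) + (ε : ℂ) / 2) * (ζ + (ε' : ℂ) / 2)))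

lemma θf_eq_tsum (ε ε' : ℝ) (ζ τ : ℂ) : θf ε ε' ζ τ = ∑' n, θfTerm ε ε' ζ τ n := rfl

lemma θfTerm_eq_jacobiTheta₂_term (ε ε' : ℝ) (ζ τ : ℂ) (n : ℤ) :
    θfTerm ε ε' ζ τ n =
      cexp (2 * Real.pi * I * ((ε : ℂ) ^ 2 / 8 * τ + (ε : ℂ) / 2 * (ζ + (ε' : ℂ) / 2))) *
        jacobiTheta₂_term n (ζ + (ε' : ℂ) / 2 + (ε : ℂ) / 2 * τ) τ := by
  rw [θfTerm, jacobiTheta₂_term, ← Complex.exp_add]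
  ring_nf

lemma θf_eq_jacobiTheta₂ (ε ε' : ℝ) (ζ τ : ℂ) :
    θf ε ε' ζ τ =
      cexp (2 * Real.pi * I * ((ε : ℂ) ^ 2 / 8 * τ + (ε : ℂ) / 2 * (ζ + (ε' : ℂ) / 2))) *
        jacobiTheta₂ (ζ + (ε' : ℂ) / 2 + (ε : ℂ) / 2 * τ) τ := by
  simp only [θf_eq_tsum, θfTerm_eq_jacobiTheta₂_term, jacobiTheta₂, tsum_mul_left]

lemma summable_θfTerm (ε ε' : ℝ) (ζ : ℂ) {τ : ℂ} (hτ : 0 < τ.im) :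
    Summable (θfTerm ε ε' ζ τ) := by
  simp only [funext (θfTerm_eq_jacobiTheta₂_term ε ε' ζ τ)]
  exact ((summable_jacobiTheta₂_term_iff _ τ).2 hτ).mul_left _

lemma differentiable_θf (ε ε' : ℝ) {τ : ℂ} (hτ : 0 < τ.im) :
    Differentiable ℂ fun z ↦ θf ε ε' z τ := by
  intro z
  simp only [θf_eq_jacobiTheta₂]
  refine DifferentiableAt.mul (by fun_prop) ?_
  exact (differentiableAt_jacobiTheta₂_fst _ hτ).comp z
    (f := fun z ↦ z + (ε' : ℂ) / 2 + (ε : ℂ) / 2 * τ) (by fun_prop)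

lemma θf_one_one_neg (z τ : ℂ) : θf 1 1 (-z) τ = -θf 1 1 z τ := by
  rw [θf_eq_tsum, θf_eq_tsum, ← tsum_neg, ← ((Equiv.neg ℤ).trans (Equiv.subRight 1)).tsum_eq]
  refine tsum_congr fun n ↦ ?_
  rw [neg_eq_neg_one_mul (θfTerm _ _ _ _ _), ← exp_two_pi_I_mul_int_add_half (-n - 1), θfTerm,
    θfTerm, ← Complex.exp_add]
  simp only [Equiv.trans_apply, Equiv.neg_apply, Equiv.subRight_apply]
  push_cast
  ring_nf

lemma θf_one_one_add_one (z τ : ℂ) : θf 1 1 (z + 1) τ = -θf 1 1 z τ := by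
  rw [θf_eq_tsum, θf_eq_tsum, ← tsum_neg]
  refine tsum_congr fun n ↦ ?_
  rw [neg_eq_neg_one_mul (θfTerm _ _ _ _ _), ← exp_two_pi_I_mul_int_add_half n, θfTerm,
    θfTerm, ← Complex.exp_add]
  push_cast
  ring_nf

/-- Pairs of integers, sorted by the parity of their sum. -/
noncomputable def sumProdEquivParity : (ℤ × ℤ) ⊕ (ℤ × ℤ) ≃ ℤ × ℤ :=
  Equiv.ofBijective
    (Sum.elim (fun p ↦ (p.1 + p.2, p.1 - p.2)) (fun p ↦ (p.1 + p.2, p.1 - p.2 - 1))) <| by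
    constructor
    · rintro (⟨a, b⟩ | ⟨a, b⟩) (⟨c, d⟩ | ⟨c, d⟩) h <;>
        simp only [Sum.elim_inl, Sum.elim_inr, Prod.mk.injEq, Sum.inl.injEq, Sum.inr.injEq,
          reduceCtorEq] at h ⊢ <;> omega
    · rintro ⟨n, m⟩
      rcases Int.even_or_odd' (n + m) with ⟨k, hk | hk⟩
      · exact ⟨.inl (k, n - k), Prod.ext (by simp) (by simp; omega)⟩
      · exact ⟨.inr (k + 1, n - k - 1), Prod.ext (by simp) (by simp; omega)⟩

lemma sumProdEquivParity_inl (p : ℤ × ℤ) :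
    sumProdEquivParity (.inl p) = (p.1 + p.2, p.1 - p.2) := rfl

lemma sumProdEquivParity_inr (p : ℤ × ℤ) :
    sumProdEquivParity (.inr p) = (p.1 + p.2, p.1 - p.2 - 1) := rfl

lemma θf_one_one_add_mul_sub (x y : ℂ) {τ : ℂ} (hτ : 0 < τ.im) :
    θf 1 1 (x + y) τ * θf 1 1 (x - y) τ =
      θf 0 0 (2 * x) (2 * τ) * θf 1 0 (2 * y) (2 * τ) -
        θf 1 0 (2 * x) (2 * τ) * θf 0 0 (2 * y) (2 * τ) := by
  have h2τ : 0 < (2 * τ).im := by simpa using hτ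
  have key (ε₁ ε₁' ε₂ ε₂' : ℝ) (z w : ℂ) {σ : ℂ} (hσ : 0 < σ.im) :
      HasSum (fun p : ℤ × ℤ ↦ θfTerm ε₁ ε₁' z σ p.1 * θfTerm ε₂ ε₂' w σ p.2)
        (θf ε₁ ε₁' z σ * θf ε₂ ε₂' w σ) := by
    have h₁ := summable_θfTerm ε₁ ε₁' z hσ
    have h₂ := summable_θfTerm ε₂ ε₂' w hσ
    exact h₁.hasSum.mul h₂.hasSum (summable_mul_of_summable_norm h₁.norm h₂.norm)
  have h := sumProdEquivParity.hasSum_iff.2 (key 1 1 1 1 (x + y) (x - y) hτ)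
  rw [sub_eq_neg_add (θf 0 0 _ _ * _)]
  refine h.unique (HasSum.sum ?_ ?_)
  · convert! (key 1 0 0 0 (2 * x) (2 * y) h2τ).neg using 2 with p
    rw [neg_eq_neg_one_mul, ← exp_two_pi_I_mul_int_add_half p.1]
    simp only [Function.comp_apply, sumProdEquivParity_inl, θfTerm, ← Complex.exp_add]
    push_cast
    ring_nf
  · convert! key 0 0 1 0 (2 * x) (2 * y) h2τ using 2 with p
    rw [← one_mul (_ * _), ← exp_int_mul_two_pi_mul_I p.1]
    simp only [Function.comp_apply, sumProdEquivParity_inr, θfTerm, ← Complex.exp_add]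
    push_cast
    ring_nf

/-- The three-term relation of Weierstrass. -/
lemma θf_one_one_three_term (x a b c : ℂ) {τ : ℂ} (hτ : 0 < τ.im) :
    θf 1 1 (x + a) τ * θf 1 1 (x - a) τ * (θf 1 1 (b + c) τ * θf 1 1 (b - c) τ) +
      θf 1 1 (x + b) τ * θf 1 1 (x - b) τ * (θf 1 1 (c + a) τ * θf 1 1 (c - a) τ) +
      θf 1 1 (x + c) τ * θf 1 1 (x - c) τ * (θf 1 1 (a + b) τ * θf 1 1 (a - b) τ) = 0 := by
  simp only [θf_one_one_add_mul_sub _ _ hτ]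
  ring

lemma θf_one_one_fifths_relation (w : ℂ) {τ : ℂ} (hτ : 0 < τ.im) :
    θf 1 1 (1 / 5) τ ^ 2 * θf 1 1 (w - 1 / 5) τ * θf 1 1 (w - 2 / 5) τ -
      θf 1 1 (1 / 5) τ * θf 1 1 (2 / 5) τ * θf 1 1 (w + 1 / 5) τ ^ 2 +
      θf 1 1 (2 / 5) τ ^ 2 * θf 1 1 (w + 2 / 5) τ * θf 1 1 w τ = 0 := by
  have h := θf_one_one_three_term (w + 1 / 5) (3 / 5) 0 (1 / 5) hτ
  rw [show w + 1 / 5 + 3 / 5 = w - 1 / 5 + 1 by ring, show w + 1 / 5 - 3 / 5 = w - 2 / 5 by ring,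
    show w + 1 / 5 + 1 / 5 = w + 2 / 5 by ring, add_sub_cancel_right, add_zero, sub_zero,
    zero_add, zero_sub, add_zero, sub_zero, show (1 / 5 + 3 / 5 : ℂ) = -(1 / 5) + 1 by norm_num,
    show (1 / 5 - 3 / 5 : ℂ) = -(2 / 5) by norm_num,
    show (3 / 5 : ℂ) = -(2 / 5) + 1 by norm_num] at h
  simp only [θf_one_one_add_one, θf_one_one_neg] at h
  linear_combination h

lemma θf_one_one_fifths_quartic_relation (w : ℂ) {τ : ℂ} (hτ : 0 < τ.im) :
    θf 1 1 (1 / 5) τ * θf 1 1 (w - 2 / 5) τ ^ 2 * θf 1 1 (w - 1 / 5) τ +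
      θf 1 1 (2 / 5) τ * θf 1 1 (w - 1 / 5) τ ^ 2 * θf 1 1 (w + 2 / 5) τ -
      θf 1 1 (1 / 5) τ * θf 1 1 (w + 2 / 5) τ ^ 2 * θf 1 1 (w + 1 / 5) τ -
      θf 1 1 (2 / 5) τ * θf 1 1 (w + 1 / 5) τ ^ 2 * θf 1 1 (w - 2 / 5) τ = 0 := by
  by_cases h₁ : θf 1 1 (1 / 5) τ = 0
  · by_cases h₂ : θf 1 1 (2 / 5) τ = 0
    · rw [h₁, h₂]
      ring
    have han : AnalyticOnNhd ℂ (fun z ↦ θf 1 1 z τ) Set.univ :=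
      (differentiable_θf 1 1 hτ).differentiableOn.analyticOnNhd isOpen_univ
    have han' : AnalyticOnNhd ℂ (fun z ↦ θf 1 1 (z + 2 / 5) τ) Set.univ :=
      ((differentiable_θf 1 1 hτ).comp (f := fun z ↦ z + 2 / 5)
        (by fun_prop)).differentiableOn.analyticOnNhd isOpen_univ
    have hzero : ∀ z, θf 1 1 z τ = 0 := by
      rcases han'.eq_zero_or_eq_zero_of_mul_eq_zero han
        (fun z _ ↦ by
          have h := θf_one_one_fifths_relation z hτ
          simp only [h₁] at h
          refine mul_left_cancel₀ (pow_ne_zero 2 h₂) ?_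
          linear_combination h)
        isPreconnected_univ with h | h
      · exact fun z ↦ by simpa using h (z - 2 / 5) trivial
      · exact fun z ↦ h z trivial
    simp [hzero]
  · have h := θf_one_one_fifths_relation w hτ
    have h' := θf_one_one_fifths_relation (-w) hτ
    rw [show -w - 1 / 5 = -(w + 1 / 5) by ring, show -w - 2 / 5 = -(w + 2 / 5) by ring,
      show -w + 1 / 5 = -(w - 1 / 5) by ring, show -w + 2 / 5 = -(w - 2 / 5) by ring] at h'
    simp only [θf_one_one_neg] at h'
    refine mul_left_cancel₀ h₁ ?_
    linear_combination θf 1 1 (w - 2 / 5) τ * h - θf 1 1 (w + 2 / 5) τ * h'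

lemma θf_three_fifths_eq (ε' : ℝ) (ζ τ : ℂ) :
    θf (3 / 5) ε' ζ τ =
      cexp (2 * Real.pi * I * (τ / 50 - (ζ + (ε' : ℂ) / 2) / 5)) *
        θf 1 1 (ζ - τ / 5 + ((ε' : ℂ) - 1) / 2) τ := by
  simp only [θf_eq_tsum, ← tsum_mul_left]
  refine tsum_congr fun n ↦ ?_
  rw [θfTerm, θfTerm, ← Complex.exp_add]
  push_cast
  ring_nf

lemma θ_one_eq (ε' : ℝ) (τ : ℂ) : θ 1 ε' τ = -θf 1 1 ((1 - (ε' : ℂ)) / 2) τ := by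
  rw [← θf_one_one_neg, θ, θf_eq_tsum, θf_eq_tsum]
  refine tsum_congr fun n ↦ ?_
  rw [θfTerm, θfTerm]
  push_cast
  ring_nf

theorem three_theta_threefifths (ζ : ℂ) (τ : ℂ) (hτ : 0 < τ.im) :
    θ 1 (3/5) τ * θf (3/5) (1/5) ζ τ ^ 2 * θf (3/5) (3/5) ζ τ + ζ₅ * θ 1 (1/5) τ * θf (3/5) (3/5) ζ τ ^ 2 * θf (3/5) (9/5) ζ τ - ζ₅ ^ 2 * θ 1 (3/5) τ * θf (3/5) (9/5) ζ τ ^ 2 * θf (3/5) (7/5) ζ τ - ζ₅ * θ 1 (1/5) τ * θf (3/5) (7/5) ζ τ ^ 2 * θf (3/5) (1/5) ζ τ = 0 := by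
  set w := ζ - τ / 5 with hw
  set C := cexp (2 * Real.pi * I * (τ / 50 - ζ / 5)) with hC
  set η := cexp (-(2 * Real.pi * I / 50)) with hη
  have hζ₅ : ζ₅ * η ^ 10 = 1 := by
    rw [hη, ζ₅, ← Complex.exp_nat_mul, ← Complex.exp_add, Complex.exp_eq_one_iff]
    exact ⟨0, by push_cast; ring⟩
  have hθ (k : ℕ) : θf (3 / 5) (k / 5) ζ τ = C * η ^ k * θf 1 1 (w + ((k : ℂ) / 5 - 1) / 2) τ := by
    rw [θf_three_fifths_eq, hC, hη, ← Complex.exp_nat_mul, ← Complex.exp_add, hw]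
    push_cast
    ring_nf
  have t₁ := hθ 1
  have t₃ := hθ 3
  have t₇ := hθ 7
  have t₉ := hθ 9
  push_cast at t₁ t₃ t₇ t₉
  rw [show w + ((1 : ℂ) / 5 - 1) / 2 = w - 2 / 5 by ring] at t₁
  rw [show w + ((3 : ℂ) / 5 - 1) / 2 = w - 1 / 5 by ring] at t₃
  rw [show w + ((7 : ℂ) / 5 - 1) / 2 = w + 1 / 5 by ring] at t₇
  rw [show w + ((9 : ℂ) / 5 - 1) / 2 = w + 2 / 5 by ring] at t₉
  have s₁ : θ 1 (3 / 5) τ = -θf 1 1 (1 / 5) τ := by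
    rw [θ_one_eq]; push_cast; norm_num
  have s₂ : θ 1 (1 / 5) τ = -θf 1 1 (2 / 5) τ := by
    rw [θ_one_eq]; push_cast; norm_num
  rw [s₁, s₂, t₁, t₃, t₇, t₉]
  linear_combination (-C ^ 3 * η ^ 5) * θf_one_one_fifths_quartic_relation w hτ +
    C ^ 3 * η ^ 5 * (-θf 1 1 (2 / 5) τ * θf 1 1 (w - 1 / 5) τ ^ 2 * θf 1 1 (w + 2 / 5) τ +
      θf 1 1 (1 / 5) τ * θf 1 1 (w + 2 / 5) τ ^ 2 * θf 1 1 (w + 1 / 5) τ * (ζ₅ * η ^ 10 + 1) +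
      θf 1 1 (2 / 5) τ * θf 1 1 (w + 1 / 5) τ ^ 2 * θf 1 1 (w - 2 / 5) τ) * hζ₅
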